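/- arXiv:1203.0153 — 2 statements merged into one kernel-verified Lean document; each statement's English description precedes it below -/
import Mathlib

section
/- Let p > 2 be a prime and let a, b, a', b' be nonzero elements of ℤ_p ⊆ ℚ_p with a ≠ b and a' ≠ b'. Assume ab, a'b' and −aa' are squares in ℚ_p. Assume moreover ν_p(a−b) = 0 and ν_p(a'−b') = 0 (i.e., a ≢ b and a' ≢ b' (mod p)), and that at least one of a, b, a', b' has ν_p > 0. Then the evaluation map is non-constant: there exist points (x₁,u₁,z₁) and (x₂,u₂,z₂) in ℚ_p³, both with nonzero z-coordinate and both satisfying z² = x(x−a)(x−b)·u(u−a')(u−b'), such that the Hilbert symbol ((x−a)(x−b), (u−a')(u−b'))_{ℚ_p} is trivial at one of them and nontrivial at the other. -/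
/-- The Hilbert symbol `(A,B)_k` is trivial if `A·r² + B·s² = 1` is solvable. -/
def HilbertTrivial {k : Type*} [Field k] (A B : k) : Prop :=
  ∃ r s : k, A * r ^ 2 + B * s ^ 2 = 1

/-- The quaternion algebra attached to the two pairs of parameters takes both values on the points
of the Kummer surface with nonzero `z`-coordinate. -/
def EvalNonconstant {k : Type*} [Field k] (a b a' b' : k) : Prop :=
  ∃ x₁ u₁ z₁ x₂ u₂ z₂ : k,
    z₁ ≠ 0 ∧ z₁ ^ 2 = x₁ * (x₁ - a) * (x₁ - b) * (u₁ * (u₁ - a') * (u₁ - b')) ∧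
    z₂ ≠ 0 ∧ z₂ ^ 2 = x₂ * (x₂ - a) * (x₂ - b) * (u₂ * (u₂ - a') * (u₂ - b')) ∧
    HilbertTrivial ((x₁ - a) * (x₁ - b)) ((u₁ - a') * (u₁ - b')) ∧
    ¬HilbertTrivial ((x₂ - a) * (x₂ - b)) ((u₂ - a') * (u₂ - b'))

section Field

variable {k : Type*} [Field k] {a b a' b' : k}

theorem HilbertTrivial.symm {A B : k} (h : HilbertTrivial A B) : HilbertTrivial B A := by
  obtain ⟨r, s, h⟩ := h
  exact ⟨s, r, by rw [add_comm, h]⟩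

theorem EvalNonconstant.swap_left (h : EvalNonconstant a b a' b') :
    EvalNonconstant b a a' b' := by
  obtain ⟨x₁, u₁, z₁, x₂, u₂, z₂, h₁, e₁, h₂, e₂, t, n⟩ := h
  refine ⟨x₁, u₁, z₁, x₂, u₂, z₂, h₁, by rw [e₁]; ring, h₂, by rw [e₂]; ring, ?_, ?_⟩
  · rwa [mul_comm (x₁ - b)]
  · rwa [mul_comm (x₂ - b)]

theorem EvalNonconstant.swap (h : EvalNonconstant a b a' b') : EvalNonconstant a' b' a b := by
  obtain ⟨x₁, u₁, z₁, x₂, u₂, z₂, h₁, e₁, h₂, e₂, t, n⟩ := h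
  exact ⟨u₁, x₁, z₁, u₂, x₂, z₂, h₁, by rw [e₁]; ring, h₂, by rw [e₂]; ring, t.symm,
    fun h ↦ n h.symm⟩

theorem EvalNonconstant.swap_right (h : EvalNonconstant a b a' b') :
    EvalNonconstant a b b' a' :=
  h.swap.swap_left.swap

/-- A pair with `ab` a square may be written as `(bc², b)`. -/
theorem exists_eq_mul_sq_of_isSquare_mul (hb : b ≠ 0) (h : IsSquare (a * b)) :
    ∃ c, a = b * c ^ 2 := by
  obtain ⟨t, ht⟩ := h
  refine ⟨t / b, ?_⟩
  field_simp
  rw [ht, sq]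

theorem IsSquare.of_mul_left {x y : k} (hx : x ≠ 0) (h : IsSquare x) (hxy : IsSquare (x * y)) :
    IsSquare y := by
  have := hxy.div h
  rwa [mul_div_cancel_left₀ _ hx] at this

theorem FiniteField.isSquare_mul_of_not_isSquare [Finite k] {x y : k}
    (hx : ¬IsSquare x) (hy : ¬IsSquare y) : IsSquare (x * y) := by
  classical
  have := Fintype.ofFinite k
  have hx0 : x ≠ 0 := by rintro rfl; exact hx .zero
  have hy0 : y ≠ 0 := by rintro rfl; exact hy .zero
  rw [← quadraticChar_one_iff_isSquare (mul_ne_zero hx0 hy0), map_mul,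
    quadraticChar_neg_one_iff_not_isSquare.2 hx, quadraticChar_neg_one_iff_not_isSquare.2 hy]
  norm_num

/-- Translation by the 2-torsion point `(1, 0)` on `y² = v(v-d²)(v-1)` shows that this curve has a
point with `y ≠ 0` and `v` not a square. -/
theorem FiniteField.exists_not_isSquare_and_not_isSquare [Finite k] (hk : ringChar k ≠ 2) {d : k}
    (hd : d ^ 2 ≠ 1) : ∃ v : k, ¬IsSquare v ∧ ¬IsSquare ((v - d ^ 2) * (v - 1)) := by
  by_contra! H
  obtain ⟨g, hg⟩ := FiniteField.exists_nonsquare hk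
  have hg0 : g ≠ 0 := by rintro rfl; exact hg .zero
  have ne_one {v : k} (hv : ¬IsSquare v) : v - 1 ≠ 0 := by
    rintro h
    exact hv (by rw [sub_eq_zero.1 h]; exact .one)
  have ne_sq {v : k} (hv : ¬IsSquare v) : v - d ^ 2 ≠ 0 := by
    rintro h
    exact hv (by rw [sub_eq_zero.1 h]; exact .sq d)
  let φ : {v : k // ¬IsSquare v} → {v : k // ¬IsSquare v} := fun v ↦
    ⟨g * ((v - d ^ 2) / (v - 1)), fun h ↦ by
      have hs : IsSquare ((v - d ^ 2) / ((v : k) - 1)) := by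
        have := (H v v.2).div (IsSquare.sq ((v : k) - 1))
        rwa [sq ((v : k) - 1), mul_div_mul_right _ _ (ne_one v.2)] at this
      rw [mul_comm] at h
      exact hg (hs.of_mul_left (div_ne_zero (ne_sq v.2) (ne_one v.2)) h)⟩
  have hφ : Function.Injective φ := by
    intro v w hvw
    have h := mul_left_cancel₀ hg0 (congrArg Subtype.val hvw)
    rw [div_eq_div_iff (ne_one v.2) (ne_one w.2)] at h
    have : (d ^ 2 - 1) * ((v : k) - w) = 0 := by linear_combination h
    exact Subtype.ext (sub_eq_zero.1 ((mul_eq_zero.1 this).resolve_left (sub_ne_zero.2 hd)))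
  obtain ⟨v, hv⟩ := Finite.surjective_of_injective hφ ⟨g, hg⟩
  have h := congrArg Subtype.val hv
  have h1 : ((v : k) - d ^ 2) / (v - 1) = 1 := mul_left_cancel₀ hg0 (h.trans (mul_one g).symm)
  rw [div_eq_one_iff_eq (ne_one v.2)] at h1
  exact hd (sub_right_injective h1)

end Field

section Padic

variable {p : ℕ} [Fact p.Prime]

theorem PadicInt.toZMod_eq_zero_iff {z : ℤ_[p]} : toZMod z = 0 ↔ ‖z‖ < 1 := by
  rw [← RingHom.mem_ker, ker_toZMod, IsLocalRing.mem_maximalIdeal, mem_nonunits]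

theorem PadicInt.isSquare_of_isSquare_toZMod (hp : 2 < p) {z : ℤ_[p]} (hz : toZMod z ≠ 0)
    (h : IsSquare (toZMod z)) : IsSquare z := by
  obtain ⟨t, ht⟩ := h
  obtain ⟨w, rfl⟩ := ZMod.ringHom_surjective (toZMod (p := p)) t
  have hw : ‖(2 * w : ℤ_[p])‖ = 1 := by
    refine le_antisymm (norm_le_one _) (not_lt.1 fun h ↦ ?_)
    rw [← toZMod_eq_zero_iff, map_mul, mul_eq_zero] at h
    rcases h with h | h
    · have : ((2 : ℕ) : ZMod p) = 0 := by simpa only [map_ofNat, Nat.cast_ofNat] using h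
      rw [ZMod.natCast_eq_zero_iff] at this
      exact absurd (Nat.le_of_dvd two_pos this) (by omega)
    · exact hz (by rw [ht, h, zero_mul])
  have hF : ‖(w ^ 2 - z : ℤ_[p])‖ < 1 := by
    rw [← toZMod_eq_zero_iff, map_sub, map_pow, ht]
    ring
  obtain ⟨y, hy, -⟩ := hensels_lemma (F := (Polynomial.X ^ 2 - Polynomial.C z)) (a := w)
    (by simpa [hw, one_add_one_eq_two] using hF)
  exact ⟨y, by simp at hy; linear_combination -hy⟩

theorem PadicInt.isSquare_toZMod_of_isSquare_coe {z : ℤ_[p]} (h : IsSquare (z : ℚ_[p])) :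
    IsSquare (toZMod z) := by
  obtain ⟨t, ht⟩ := h
  have h1 : ‖t‖ ≤ 1 := by
    have h2 : ‖t‖ * ‖t‖ ≤ 1 := by
      rw [← norm_mul, ← ht]
      exact z.2
    nlinarith [norm_nonneg t]
  refine IsSquare.map toZMod ⟨⟨t, h1⟩, ?_⟩
  exact Subtype.ext ht

theorem PadicInt.isSquare_coe_of_isSquare_toZMod (hp : 2 < p) {z : ℤ_[p]} (hz : toZMod z ≠ 0)
    (h : IsSquare (toZMod z)) : IsSquare (z : ℚ_[p]) :=
  (isSquare_of_isSquare_toZMod hp hz h).map Coe.ringHom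

theorem Padic.isSquare_one_sub (hp : 2 < p) {y : ℚ_[p]} (hy : ‖y‖ < 1) : IsSquare (1 - y) := by
  obtain ⟨z, rfl⟩ : ∃ z : ℤ_[p], (z : ℚ_[p]) = y := ⟨⟨y, hy.le⟩, rfl⟩
  have h : PadicInt.toZMod (1 - z) = 1 := by
    rw [map_sub, map_one, PadicInt.toZMod_eq_zero_iff.2 hy, sub_zero]
  have := PadicInt.isSquare_coe_of_isSquare_toZMod hp (by rw [h]; exact one_ne_zero)
    (by rw [h]; exact .one)
  rwa [PadicInt.coe_sub, PadicInt.coe_one] at this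

theorem Padic.isSquare_mul_sub (hp : 2 < p) {x a : ℚ_[p]} (h : ‖a‖ < ‖x‖) :
    IsSquare (x * (x - a)) := by
  have hx : 0 < ‖x‖ := (norm_nonneg a).trans_lt h
  have hx0 : x ≠ 0 := norm_pos_iff.1 hx
  have : IsSquare (x ^ 2 * (1 - a / x)) :=
    (IsSquare.sq x).mul (isSquare_one_sub hp (by rwa [norm_div, div_lt_one hx]))
  convert this using 1
  field_simp

theorem Padic.norm_sq_ne_norm_p (t : ℚ_[p]) : ‖t‖ ^ 2 ≠ ‖(p : ℚ_[p])‖ := by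
  have hp : (p : ℚ_[p]) ≠ 0 := Nat.cast_ne_zero.2 (Fact.out : p.Prime).ne_zero
  intro h
  have ht : t ≠ 0 := by
    rintro rfl
    exact hp (norm_eq_zero.1 (by simpa using h.symm))
  rw [← norm_pow, norm_eq_zpow_neg_valuation (pow_ne_zero 2 ht), norm_eq_zpow_neg_valuation hp,
    valuation_pow, valuation_p] at h
  have h1 : (1 : ℝ) < p := Nat.one_lt_cast.2 (Fact.out : p.Prime).one_lt
  have := zpow_right_injective₀ (by linarith) h1.ne' h
  push_cast at this
  omega

theorem Padic.not_hilbertTrivial (hp : 2 < p) {A B : ℚ_[p]} (hA : ‖A‖ = ‖(p : ℚ_[p])‖)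
    (hB : ‖B‖ = 1) (hsq : ¬IsSquare B) : ¬HilbertTrivial A B := by
  rintro ⟨r, s, h⟩
  have hBs : B * s ^ 2 = 1 - A * r ^ 2 := by linear_combination h
  have ne {t : ℚ_[p]} : ‖A * r ^ 2‖ = ‖t ^ 2‖ → r = 0 := by
    intro e
    by_contra hr
    have hr' : ‖r‖ ≠ 0 := norm_ne_zero_iff.2 hr
    apply norm_sq_ne_norm_p (t / r)
    rw [norm_mul, norm_pow, norm_pow, hA] at e
    rw [norm_div, div_pow, ← e]
    field_simp
  have key : ‖A * r ^ 2‖ < 1 → False := by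
    intro hlt
    have hs : s ≠ 0 := by
      rintro rfl
      have : A * r ^ 2 = 1 := by simpa using h
      simp [this] at hlt
    have := isSquare_one_sub hp hlt
    rw [← hBs, mul_comm] at this
    exact hsq ((IsSquare.sq s).of_mul_left (pow_ne_zero 2 hs) this)
  rcases lt_trichotomy ‖A * r ^ 2‖ 1 with hlt | heq | hgt
  · exact key hlt
  · have : r = 0 := ne (t := 1) (by simpa using heq)
    simp [this] at heq
  · have hn : ‖(1 : ℚ_[p]) - A * r ^ 2‖ = ‖A * r ^ 2‖ := by
      rw [sub_eq_add_neg, IsUltrametricDist.norm_add_eq_max_of_norm_ne_norm, norm_neg, norm_one,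
        max_eq_right hgt.le]
      rw [norm_neg, norm_one]
      exact hgt.ne
    have : r = 0 := ne (t := s) (by rw [← hn, ← hBs, norm_mul, hB, one_mul])
    simp [this] at hgt
    linarith

/-- Existence of a point where the symbol is trivial: take `x` of large norm. -/
theorem Padic.exists_hilbertTrivial (hp : 2 < p) {a b a' b' u : ℚ_[p]} (ha : ‖a‖ ≤ 1)
    (hb : ‖b‖ ≤ 1) (hu : ‖u * (u - a') * (u - b')‖ = 1) :
    ∃ x z : ℚ_[p], z ≠ 0 ∧ z ^ 2 = x * (x - a) * (x - b) * (u * (u - a') * (u - b')) ∧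
      HilbertTrivial ((x - a) * (x - b)) ((u - a') * (u - b')) := by
  set w := u * (u - a') * (u - b') with hw
  have hp0 : (p : ℚ_[p]) ≠ 0 := Nat.cast_ne_zero.2 (Fact.out : p.Prime).ne_zero
  have hw0 : w ≠ 0 := norm_ne_zero_iff.1 (by rw [hu]; exact one_ne_zero)
  obtain ⟨x, hx⟩ : ∃ x, x = w / (p : ℚ_[p]) ^ 2 := ⟨_, rfl⟩
  have hx1 : 1 < ‖x‖ := by
    have h1 : (1 : ℝ) < p := Nat.one_lt_cast.2 (Fact.out : p.Prime).one_lt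
    rw [hx, norm_div, hu, norm_pow, norm_p, inv_pow, one_div, inv_inv]
    exact one_lt_pow₀ h1 two_ne_zero
  have hx0 : x ≠ 0 := norm_pos_iff.1 (one_pos.trans hx1)
  have sub_ne {c : ℚ_[p]} (hc : ‖c‖ ≤ 1) : x - c ≠ 0 := by
    intro h
    rw [sub_eq_zero.1 h] at hx1
    linarith
  have hsq : IsSquare ((x - a) * (x - b)) := by
    refine (IsSquare.sq x).of_mul_left (pow_ne_zero 2 hx0) ?_
    refine (congrArg IsSquare ?_).mp ((isSquare_mul_sub hp (ha.trans_lt hx1)).mul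
      (isSquare_mul_sub hp (hb.trans_lt hx1)))
    ring
  obtain ⟨t, ht⟩ := hsq
  have ht0 : t ≠ 0 := by
    rintro rfl
    exact mul_ne_zero (sub_ne ha) (sub_ne hb) (by simpa using ht)
  refine ⟨x, w / p * t, mul_ne_zero (div_ne_zero hw0 hp0) ht0, ?_, t⁻¹, 0, ?_⟩
  · rw [mul_assoc x, ht, hx]
    field_simp
  · rw [ht]
    field_simp
    simp

theorem Padic.evalNonconstant_mul_sq (hp : 2 < p) {b c b' d : ℚ_[p]} (hb : ‖b‖ = 1)
    (hb' : ‖b'‖ = 1) (hc : ‖c‖ < 1) (hd : ‖d‖ ≤ 1) (hd' : ‖b' * d ^ 2 - b'‖ = 1)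
    (hsq : IsSquare (-(b * b'))) : EvalNonconstant (b * c ^ 2) b (b' * d ^ 2) b' := by
  have hp0 : (p : ℚ_[p]) ≠ 0 := Nat.cast_ne_zero.2 (Fact.out : p.Prime).ne_zero
  have hb0 : b ≠ 0 := norm_ne_zero_iff.1 (by rw [hb]; exact one_ne_zero)
  have hb0' : b' ≠ 0 := norm_ne_zero_iff.1 (by rw [hb']; exact one_ne_zero)
  have hp1 : ‖(p : ℚ_[p])‖ < 1 := norm_p_lt_one
  obtain ⟨d, rfl⟩ : ∃ z : ℤ_[p], (z : ℚ_[p]) = d := ⟨⟨d, hd⟩, rfl⟩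
  have hd1 : PadicInt.toZMod d ^ 2 ≠ 1 := by
    rw [← sub_ne_zero, ← map_pow, ← map_one (PadicInt.toZMod (p := p)), ← map_sub, Ne,
      PadicInt.toZMod_eq_zero_iff, not_lt, ← PadicInt.padic_norm_e_of_padicInt]
    rw [show b' * (d : ℚ_[p]) ^ 2 - b' = b' * (d ^ 2 - 1) by ring, norm_mul, hb', one_mul] at hd'
    push_cast
    exact hd'.ge
  obtain ⟨v, hv, hQ⟩ := FiniteField.exists_not_isSquare_and_not_isSquare
    (by rw [ZMod.ringChar_zmod_n]; omega) hd1
  obtain ⟨V, rfl⟩ := ZMod.ringHom_surjective (PadicInt.toZMod (p := p)) v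
  obtain ⟨Q, hQV⟩ : ∃ Q : ℤ_[p], Q = (V - d ^ 2) * (V - 1) := ⟨_, rfl⟩
  replace hQ : ¬IsSquare (PadicInt.toZMod Q) := by simpa [hQV] using hQ
  have norm_one {z : ℤ_[p]} (hz : PadicInt.toZMod z ≠ 0) : ‖(z : ℚ_[p])‖ = 1 := by
    rw [PadicInt.padic_norm_e_of_padicInt]
    exact le_antisymm (PadicInt.norm_le_one _)
      (not_lt.1 fun h ↦ hz (PadicInt.toZMod_eq_zero_iff.2 h))
  have hQ0 : PadicInt.toZMod Q ≠ 0 := fun h ↦ hQ (by rw [h]; exact .zero)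
  have hV0 : PadicInt.toZMod V ≠ 0 := fun h ↦ hv (by rw [h]; exact .zero)
  have hVQ : IsSquare ((V : ℚ_[p]) * Q) := by
    rw [← PadicInt.coe_mul]
    apply PadicInt.isSquare_coe_of_isSquare_toZMod hp
    · rw [map_mul]
      exact mul_ne_zero hV0 hQ0
    · rw [map_mul]
      exact FiniteField.isSquare_mul_of_not_isSquare hv hQ
  have hQc : (Q : ℚ_[p]) = (V - d ^ 2) * (V - 1) := by rw [hQV]; push_cast; rfl
  obtain ⟨u, hu⟩ : ∃ u, u = b' * (V : ℚ_[p]) := ⟨_, rfl⟩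
  have hB : (u - b' * d ^ 2) * (u - b') = b' ^ 2 * Q := by rw [hu, hQc]; ring
  have hBn : ‖(u - b' * d ^ 2) * (u - b')‖ = 1 := by
    rw [hB, norm_mul, norm_pow, hb', norm_one hQ0]
    norm_num
  have hun : ‖u‖ = 1 := by rw [hu, norm_mul, hb', norm_one hV0, one_mul]
  have hac : ‖b * c ^ 2‖ < ‖(p : ℚ_[p])‖ := by
    have : ‖c‖ ≤ ‖(p : ℚ_[p])‖ := by
      have := (norm_lt_pow_iff_norm_le_pow_sub_one c 0).1 (by simpa using hc)
      simpa using this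
    rw [norm_mul, hb, one_mul, norm_pow]
    nlinarith [norm_nonneg c, norm_pos_iff.2 hp0]
  obtain ⟨x₁, z₁, hz₁, e₁, t₁⟩ := exists_hilbertTrivial hp (a := b * c ^ 2) (b := b)
    (a' := b' * d ^ 2) (b' := b') (u := u) (hac.trans hp1).le hb.le
    (by rw [mul_assoc, norm_mul, hun, hBn, one_mul])
  have hAn : ‖((p : ℚ_[p]) - b * c ^ 2) * (p - b)‖ = ‖(p : ℚ_[p])‖ := by
    have h1 : ‖(p : ℚ_[p]) - b * c ^ 2‖ = ‖(p : ℚ_[p])‖ := by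
      rw [sub_eq_add_neg, IsUltrametricDist.norm_add_eq_max_of_norm_ne_norm, norm_neg,
        max_eq_left hac.le]
      rw [norm_neg]
      exact hac.ne'
    have h2 : ‖(p : ℚ_[p]) - b‖ = 1 := by
      rw [sub_eq_add_neg, IsUltrametricDist.norm_add_eq_max_of_norm_ne_norm, norm_neg, hb,
        max_eq_right hp1.le]
      rw [norm_neg, hb]
      exact hp1.ne
    rw [norm_mul, h1, h2, mul_one]
  have hS : IsSquare ((p : ℚ_[p]) * (p - b * c ^ 2) * (p - b) *
      (u * (u - b' * d ^ 2) * (u - b'))) := by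
    refine (IsSquare.sq b).of_mul_left (pow_ne_zero 2 hb0) ?_
    refine (congrArg IsSquare ?_).mp ((((isSquare_mul_sub hp hac).mul
      (isSquare_mul_sub hp (hp1.trans_eq hb.symm))).mul hsq).mul ((IsSquare.sq b').mul hVQ))
    rw [mul_assoc u, hB, hu]
    ring
  obtain ⟨z₂, hz₂⟩ := hS
  refine ⟨x₁, u, z₁, p, u, z₂, hz₁, e₁, ?_, by rw [hz₂, sq], t₁,
    not_hilbertTrivial hp hAn hBn fun h ↦ ?_⟩
  · rintro rfl
    have ne_zero {t : ℚ_[p]} (ht : ‖t‖ ≠ 0) : t ≠ 0 := norm_ne_zero_iff.1 ht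
    have h1 := mul_ne_zero (mul_ne_zero hp0 (ne_zero (by rwa [hAn, norm_ne_zero_iff])))
      (mul_ne_zero (ne_zero (t := u) (by rw [hun]; exact one_ne_zero))
        (ne_zero (by rw [hBn]; exact one_ne_zero)))
    refine h1 (Eq.trans ?_ (hz₂.trans (mul_zero 0)))
    ring
  · rw [hB] at h
    exact hQ (PadicInt.isSquare_toZMod_of_isSquare_coe
      ((IsSquare.sq b').of_mul_left (pow_ne_zero 2 hb0') h))

theorem Padic.norm_eq_one_of_norm_sub_eq_one {a b : ℚ_[p]} (ha : ‖a‖ < 1) (h : ‖a - b‖ = 1) :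
    ‖b‖ = 1 := by
  rw [norm_sub_rev] at h
  rw [← h]
  refine (norm_eq_of_norm_sub_lt_left ?_).symm
  rw [h]
  simpa using ha

theorem Padic.evalNonconstant_of_norm_left_lt_one (hp : 2 < p) {a b a' b' : ℚ_[p]} (ha0 : a ≠ 0)
    (ha0' : a' ≠ 0) (ha : ‖a‖ < 1) (hd : ‖a - b‖ = 1) (ha' : ‖a'‖ ≤ 1) (hb' : ‖b'‖ = 1)
    (hd' : ‖a' - b'‖ = 1) (hsq₁ : IsSquare (a * b)) (hsq₂ : IsSquare (a' * b'))
    (hsq₃ : IsSquare (-(a * a'))) : EvalNonconstant a b a' b' := by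
  have hb := norm_eq_one_of_norm_sub_eq_one ha hd
  have hsq : IsSquare (-(b * b')) := by
    refine (IsSquare.sq (a * a')).of_mul_left (pow_ne_zero 2 (mul_ne_zero ha0 ha0')) ?_
    refine (congrArg IsSquare ?_).mp ((hsq₁.mul hsq₂).mul hsq₃)
    ring
  obtain ⟨c, rfl⟩ := exists_eq_mul_sq_of_isSquare_mul
    (norm_ne_zero_iff.1 (by rw [hb]; exact one_ne_zero)) hsq₁
  obtain ⟨d, rfl⟩ := exists_eq_mul_sq_of_isSquare_mul
    (norm_ne_zero_iff.1 (by rw [hb']; exact one_ne_zero)) hsq₂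
  rw [norm_mul, hb, one_mul, norm_pow, sq_lt_one_iff₀ (norm_nonneg c)] at ha
  rw [norm_mul, hb', one_mul, norm_pow, sq_le_one_iff₀ (norm_nonneg d)] at ha'
  exact evalNonconstant_mul_sq hp hb hb' ha ha' hd' hsq

theorem Padic.evalNonconstant_of_norm_lt_one (hp : 2 < p) {a b a' b' : ℚ_[p]} (ha0 : a ≠ 0)
    (ha0' : a' ≠ 0) (hb0' : b' ≠ 0) (ha : ‖a‖ < 1) (hd : ‖a - b‖ = 1) (ha' : ‖a'‖ ≤ 1)
    (hb' : ‖b'‖ ≤ 1) (hd' : ‖a' - b'‖ = 1) (hsq₁ : IsSquare (a * b)) (hsq₂ : IsSquare (a' * b'))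
    (hsq₃ : IsSquare (-(a * a'))) : EvalNonconstant a b a' b' := by
  rcases hb'.lt_or_eq with h | h
  · rw [norm_sub_rev] at hd'
    refine (evalNonconstant_of_norm_left_lt_one hp ha0 hb0' ha hd hb'
      (norm_eq_one_of_norm_sub_eq_one h hd') hd' hsq₁ (by rwa [mul_comm]) ?_).swap_right
    refine (IsSquare.sq a').of_mul_left (pow_ne_zero 2 ha0') ?_
    refine (congrArg IsSquare ?_).mp (hsq₂.mul hsq₃)
    ring
  · exact evalNonconstant_of_norm_left_lt_one hp ha0 ha0' ha hd ha' h hd' hsq₁ hsq₂ hsq₃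

theorem Padic.norm_lt_one_of_valuation_pos {x : ℚ_[p]} (h : 0 < x.valuation) : ‖x‖ < 1 := by
  have hx : x ≠ 0 := by rintro rfl; simp at h
  rw [norm_eq_zpow_neg_valuation hx]
  exact zpow_lt_one_of_neg₀ (Nat.one_lt_cast.2 (Fact.out : p.Prime).one_lt) (by omega)

theorem Padic.norm_eq_one_of_valuation_eq_zero {x : ℚ_[p]} (hx : x ≠ 0) (h : x.valuation = 0) :
    ‖x‖ = 1 := by
  rw [norm_eq_zpow_neg_valuation hx, h, neg_zero, zpow_zero]

end Padic

theorem stmt7 (p : ℕ) [Fact p.Prime] (hp : 2 < p) (a b a' b' : ℚ_[p])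
    (ha : a ≠ 0) (hb : b ≠ 0) (ha' : a' ≠ 0) (hb' : b' ≠ 0)
    (haZ : 0 ≤ a.valuation) (hbZ : 0 ≤ b.valuation)
    (haZ' : 0 ≤ a'.valuation) (hbZ' : 0 ≤ b'.valuation)
    (hab : a ≠ b) (hab' : a' ≠ b')
    (hsq1 : IsSquare (a * b)) (hsq2 : IsSquare (a' * b')) (hsq3 : IsSquare (-(a * a')))
    (hd : (a - b).valuation = 0) (hd' : (a' - b').valuation = 0)
    (hbad : 0 < a.valuation ∨ 0 < b.valuation ∨ 0 < a'.valuation ∨ 0 < b'.valuation) :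
    ∃ x₁ u₁ z₁ x₂ u₂ z₂ : ℚ_[p],
      z₁ ≠ 0 ∧ z₁ ^ 2 = x₁ * (x₁ - a) * (x₁ - b) * (u₁ * (u₁ - a') * (u₁ - b')) ∧
      z₂ ≠ 0 ∧ z₂ ^ 2 = x₂ * (x₂ - a) * (x₂ - b) * (u₂ * (u₂ - a') * (u₂ - b')) ∧
      HilbertTrivial ((x₁ - a) * (x₁ - b)) ((u₁ - a') * (u₁ - b')) ∧
      ¬HilbertTrivial ((x₂ - a) * (x₂ - b)) ((u₂ - a') * (u₂ - b')) := by
  have hsq4 {x y z : ℚ_[p]} (hx : x ≠ 0) (h : IsSquare (x * y)) (h' : IsSquare (-(x * z))) :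
      IsSquare (-(y * z)) := by
    refine (IsSquare.sq x).of_mul_left (pow_ne_zero 2 hx) ?_
    refine (congrArg IsSquare ?_).mp (h.mul h')
    ring
  rw [← Padic.norm_le_one_iff_val_nonneg] at haZ hbZ haZ' hbZ'
  replace hd := Padic.norm_eq_one_of_valuation_eq_zero (sub_ne_zero.2 hab) hd
  replace hd' := Padic.norm_eq_one_of_valuation_eq_zero (sub_ne_zero.2 hab') hd'
  have hsq1' : IsSquare (b * a) := by rwa [mul_comm]
  have hsq2' : IsSquare (b' * a') := by rwa [mul_comm]
  have hsq3' : IsSquare (-(a' * a)) := by rwa [mul_comm]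
  change EvalNonconstant a b a' b'
  rcases hbad with h | h | h | h <;> replace h := Padic.norm_lt_one_of_valuation_pos h
  · exact Padic.evalNonconstant_of_norm_lt_one hp ha ha' hb' h hd haZ' hbZ' hd' hsq1 hsq2 hsq3
  · exact (Padic.evalNonconstant_of_norm_lt_one hp hb ha' hb' h (by rwa [norm_sub_rev]) haZ' hbZ'
      hd' hsq1' hsq2 (hsq4 ha hsq1 hsq3)).swap_left
  · exact (Padic.evalNonconstant_of_norm_lt_one hp ha' ha hb h hd' haZ hbZ hd hsq2 hsq1
      hsq3').swap
  · exact (Padic.evalNonconstant_of_norm_lt_one hp hb' ha hb h (by rwa [norm_sub_rev]) haZ hbZ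
      hd hsq2' hsq1 (hsq4 ha' hsq2 hsq3')).swap_left.swap
end

section
/- Let p > 2 be a prime and let a, b, a', b' be nonzero elements of ℤ_p ⊆ ℚ_p with a ≠ b and a' ≠ b'. Assume ν_p(a−b) ≥ 1 and ν_p(a) = 0 (i.e., a ≡ b ≢ 0 (mod p), so the curve y² = x(x−a)(x−b) does not have potential good reduction). If the matrix M_{aba'b'} has at least 4 kernel vectors (i.e., its kernel has 𝔽₂-dimension ≥ 2), then there exists a nonzero kernel vector ε with ε₃ = ε₄ = 0 (i.e., ε ∈ {e₁, e₂, e₁+e₂}) such that ev_ε(P) = 0 for every point P = (x,u,z) ∈ ℚ_p³ with z ≠ 0 and z² = x(x−a)(x−b)·u(u−a')(u−b'). -/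
/-- The Skorobogatov–Zarhin matrix `M_{aba'b'}`. -/
def SZMatrix {k : Type*} [Field k] (a b a' b' : k) : Fin 4 → Fin 4 → k :=
  ![![1, a * b, a' * b', -(a * a')],
    ![a * b, 1, a * a', a' * (a' - b')],
    ![a' * b', a * a', 1, a * (a - b)],
    ![-(a * a'), a' * (a' - b'), a * (a - b), 1]]

/-- `ε ∈ 𝔽₂⁴` is a kernel vector of `M_{aba'b'}` if for every row `i` the product of
those entries `M i j` with `ε j = 1` is a square in `k`. -/
def IsKernelVector {k : Type*} [Field k] (a b a' b' : k) (ε : Fin 4 → ZMod 2) : Prop :=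
  ∀ i : Fin 4,
    IsSquare (∏ j ∈ Finset.univ.filter (fun j : Fin 4 => ε j = 1), SZMatrix a b a' b' i j)

/-- The four pairs of rational functions defining the basis quaternion algebras,
evaluated at `(x, u)`. -/
def symPair {k : Type*} [Field k] (a b a' b' x u : k) : Fin 4 → k × k :=
  ![((x - a) * (x - b), (u - a') * (u - b')),
    ((x - a) * (x - b), u * (u - b')),
    (x * (x - b), (u - a') * (u - b')),
    (x * (x - b), u * (u - b'))]

open Classical in
/-- The evaluation map `ev_ε` at the point with coordinates `(x, u)`:
the sum over those `i` with `ε i = 1` of `0` or `1` according to whether the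
`i`-th Hilbert symbol is trivial or not. -/
noncomputable def evMap {k : Type*} [Field k] (a b a' b' : k) (ε : Fin 4 → ZMod 2)
    (x u : k) : ZMod 2 :=
  ∑ i ∈ Finset.univ.filter (fun i : Fin 4 => ε i = 1),
    (if HilbertTrivial (symPair a b a' b' x u i).1 (symPair a b a' b' x u i).2
      then (0 : ZMod 2) else 1)

/-- The standard basis vectors of `𝔽₂⁴`. -/
def stdBasis (i : Fin 4) : Fin 4 → ZMod 2 := Pi.single i 1

section HilbertSymbol

variable {k : Type*} [Field k]

theorem HilbertTrivial.of_isSquare_left {A : k} (B : k) (hA : A ≠ 0) (h : IsSquare A) :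
    HilbertTrivial A B := by
  obtain ⟨c, rfl⟩ := h
  have hc : c ≠ 0 := by rintro rfl; simp at hA
  exact ⟨c⁻¹, 0, by field_simp; ring⟩

theorem HilbertTrivial.of_mul_sq {A B c : k} (h : HilbertTrivial A (B * c ^ 2)) :
    HilbertTrivial A B := by
  obtain ⟨r, s, h⟩ := h
  exact ⟨r, c * s, by rw [← h]; ring⟩

/-- The values `B` with `(D, B)` trivial are the nonzero norms from `k(√D)`, hence are closed
under multiplication. -/
theorem HilbertTrivial.mul_right (h2 : (2 : k) ≠ 0) {D B C : k} (hD : D ≠ 0)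
    (hB : HilbertTrivial D B) (hC : HilbertTrivial D C) : HilbertTrivial D (B * C) := by
  by_cases hsq : IsSquare D
  · exact .of_isSquare_left _ hD hsq
  obtain ⟨r, s, hB⟩ := hB
  obtain ⟨r', s', hC⟩ := hC
  have ne_zero : ∀ E q t : k, D * q ^ 2 + E * t ^ 2 = 1 → t ≠ 0 := by
    rintro E q t h rfl
    have hq : q ≠ 0 := by rintro rfl; simp at h
    refine hsq ⟨q⁻¹, ?_⟩
    field_simp
    linear_combination h
  have hs := ne_zero _ _ _ hB
  have hs' := ne_zero _ _ _ hC
  have key : B * C * (s * s') ^ 2 = (1 + D * r * r') ^ 2 - D * (r + r') ^ 2 := by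
    have e1 : B * s ^ 2 = 1 - D * r ^ 2 := by linear_combination hB
    have e2 : C * s' ^ 2 = 1 - D * r' ^ 2 := by linear_combination hC
    calc B * C * (s * s') ^ 2 = (B * s ^ 2) * (C * s' ^ 2) := by ring
      _ = _ := by rw [e1, e2]; ring
  apply HilbertTrivial.of_mul_sq (c := s * s')
  rw [key]
  by_cases hX : 1 + D * r * r' = 0
  · have hY : r + r' ≠ 0 := by
      intro h0
      refine hsq ⟨r⁻¹, ?_⟩
      have hr : D * r ^ 2 = 1 := by linear_combination D * r * h0 - hX
      have hr0 : r ≠ 0 := by rintro rfl; simp at hr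
      field_simp
      linear_combination hr
    refine ⟨(D⁻¹ + 1) / 2, (D⁻¹ - 1) / 2 / (r + r'), ?_⟩
    rw [hX]
    field_simp
    ring
  · refine ⟨(r + r') / (1 + D * r * r'), 1 / (1 + D * r * r'), ?_⟩
    field_simp
    ring

/-- If `W (W + α) (W + β)` and `x D` agree up to squares and `x`, `α`, `β` agree with `a` up to
squares, then `(D, (W + α) (W + β))` is trivial. -/
theorem hilbertTrivial_of_isSquare {D a x W α β z : k} (hz : z ≠ 0)
    (h : z ^ 2 = x * D * (W * (W + α) * (W + β))) (ha : a ≠ 0) (hx : IsSquare (x * a))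
    (hα : IsSquare (a * α)) (hβ : IsSquare (a * β)) :
    HilbertTrivial D ((W + α) * (W + β)) := by
  obtain ⟨m, hm⟩ := hx
  obtain ⟨s, hs⟩ := hα
  obtain ⟨t, ht⟩ := hβ
  have hne : x * D * (W * (W + α) * (W + β)) ≠ 0 := h ▸ pow_ne_zero 2 hz
  simp only [mul_ne_zero_iff] at hne
  obtain ⟨⟨hx0, hD⟩, ⟨hW, h1⟩, h2⟩ := hne
  have hm0 : m ≠ 0 := by
    rintro rfl
    simp [hx0, ha] at hm
  have hB : (W + α) * (W + β) ≠ 0 := mul_ne_zero h1 h2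
  have norm_eq : a ^ 2 * ((W + α) * (W + β)) = (s * t - a * W) ^ 2 + a * W * (s + t) ^ 2 := by
    linear_combination (a * W + a * β) * hs + (a * W + s * s) * ht
  have z_eq : m ^ 2 * D * W * ((W + α) * (W + β)) = a * z ^ 2 := by
    linear_combination (-a) * h - D * W * ((W + α) * (W + β)) * hm
  generalize (W + α) * (W + β) = B at *
  refine ⟨z * (s + t) / (m * D * B), (s * t - a * W) / (a * B), ?_⟩
  field_simp
  linear_combination (-(m ^ 2 * D * B)) * norm_eq - a * (s + t) ^ 2 * z_eq

end HilbertSymbol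

section Kernel

variable {k : Type*} [Field k] {a b a' b' : k}

theorem SZMatrix_ne_zero (ha : a ≠ 0) (hb : b ≠ 0) (ha' : a' ≠ 0) (hb' : b' ≠ 0)
    (hab : a ≠ b) (hab' : a' ≠ b') (i j : Fin 4) : SZMatrix a b a' b' i j ≠ 0 := by
  have h := sub_ne_zero.2 hab
  have h' := sub_ne_zero.2 hab'
  fin_cases i <;> fin_cases j <;> simp [SZMatrix, *]

theorem isSquare_of_mul_left {A B : k} (hA : A ≠ 0) (h : IsSquare A) (hAB : IsSquare (A * B)) :
    IsSquare B := by
  have := hAB.div h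
  rwa [mul_div_cancel_left₀ _ hA] at this

theorem isSquare_of_eq_sq_mul {A B c : k} (hc : c ≠ 0) (h : IsSquare A) (e : A = c ^ 2 * B) :
    IsSquare B :=
  isSquare_of_mul_left (pow_ne_zero 2 hc) (IsSquare.sq c) (e ▸ h)

theorem IsKernelVector.add (ha : a ≠ 0) (hb : b ≠ 0) (ha' : a' ≠ 0) (hb' : b' ≠ 0)
    (hab : a ≠ b) (hab' : a' ≠ b') {ε δ : Fin 4 → ZMod 2}
    (hε : IsKernelVector a b a' b' ε) (hδ : IsKernelVector a b a' b' δ) :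
    IsKernelVector a b a' b' (ε + δ) := by
  intro i
  have hne : ∀ s : Finset (Fin 4), ∏ j ∈ s, SZMatrix a b a' b' i j ≠ 0 := fun s =>
    Finset.prod_ne_zero_iff.2 fun j _ => SZMatrix_ne_zero ha hb ha' hb' hab hab' i j
  refine isSquare_of_mul_left (mul_ne_zero (hne _) (hne _)) ((hε i).mul (hδ i)) ?_
  simp only [Finset.prod_filter, ← Finset.prod_mul_distrib]
  refine Finset.isSquare_prod _ fun j _ => ?_
  have hcases : ∀ c : ZMod 2, c = 0 ∨ c = 1 := by decide
  have h11 : ¬((1 : ZMod 2) + 1 = 1) := by decide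
  rcases hcases (ε j) with h | h <;> rcases hcases (δ j) with h' | h' <;>
    simp [h, h', h11]

theorem exists_isKernelVector_of_four_le_ncard (ha : a ≠ 0) (hb : b ≠ 0) (ha' : a' ≠ 0)
    (hb' : b' ≠ 0) (hab : a ≠ b) (hab' : a' ≠ b') (hsq : IsSquare (a * b))
    (hker : 4 ≤ {ε : Fin 4 → ZMod 2 | IsKernelVector a b a' b' ε}.ncard) :
    ∃ ε : Fin 4 → ZMod 2, ε ≠ 0 ∧ IsKernelVector a b a' b' ε ∧ ε 2 = 0 ∧ ε 3 = 0 := by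
  by_contra! hno
  set K := {ε : Fin 4 → ZMod 2 | IsKernelVector a b a' b' ε}
  let w : (Fin 4 → ZMod 2) → ZMod 2 × ZMod 2 := fun ε => (ε 2, ε 3)
  have hchar : ∀ c : ZMod 2, c + c = 0 := by decide
  have hinj : Set.InjOn w K := by
    intro ε hε δ hδ h
    simp only [w, Prod.mk.injEq] at h
    by_contra hne
    refine hno (ε + δ) (fun h0 => hne ?_) (hε.add ha hb ha' hb' hab hab' hδ) ?_ ?_
    · funext j
      have hj : ε j + δ j = 0 := congrFun h0 j
      linear_combination hj - hchar (δ j)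
    · simp [h.1, hchar]
    · simp [h.2, hchar]
  have himage : w '' K = Set.univ := by
    apply Set.eq_of_subset_of_ncard_le (Set.subset_univ _)
    rw [hinj.ncard_image, Set.ncard_univ]
    simpa using hker
  have hcases : ∀ c : ZMod 2, c = 0 ∨ c = 1 := by decide
  have hab0 := mul_ne_zero ha hb
  obtain ⟨ε, hε, hwε⟩ : ((1, 0) : ZMod 2 × ZMod 2) ∈ w '' K := himage ▸ Set.mem_univ _
  obtain ⟨δ, hδ, hwδ⟩ : ((0, 1) : ZMod 2 × ZMod 2) ∈ w '' K := himage ▸ Set.mem_univ _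
  simp only [w, Prod.mk.injEq] at hwε hwδ
  have h13 : IsSquare (a' * b') := by
    have h := hε 0
    rcases hcases (ε 0) with h0 | h0 <;> rcases hcases (ε 1) with h1 | h1 <;>
      simp [Finset.prod_filter, Fin.prod_univ_four, SZMatrix, h0, h1, hwε] at h <;>
      first | exact h | exact isSquare_of_mul_left hab0 hsq h
  have h14 : IsSquare (-(a * a')) := by
    have h := hδ 0
    rcases hcases (δ 0) with h0 | h0 <;> rcases hcases (δ 1) with h1 | h1 <;>
      simp [Finset.prod_filter, Fin.prod_univ_four, SZMatrix, h0, h1, hwδ] at h <;>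
      first
      | exact h
      | exact isSquare_of_mul_left hab0 hsq (by convert h using 1; ring)
  refine hno ![1, 0, 0, 0] (fun h => by simpa using congrFun h 0) ?_ rfl rfl
  intro i
  fin_cases i <;>
    simp [Finset.prod_filter, Fin.prod_univ_four, SZMatrix, hsq, h13, h14]

end Kernel

/-- Two `p`-adic numbers that are relatively close agree up to squares, for odd `p`. -/
theorem Padic.isSquare_mul_of_norm_sub_lt {p : ℕ} [Fact p.Prime] (hp : 2 < p) {x y : ℚ_[p]}
    (h : ‖x - y‖ < ‖y‖) : IsSquare (x * y) := by
  have hy : y ≠ 0 := by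
    rintro rfl
    simp at h
    exact absurd h (norm_nonneg x).not_gt
  have hc : ‖x / y - 1‖ < 1 := by
    rw [show x / y - 1 = (x - y) / y by field_simp, norm_div]
    exact (div_lt_one (norm_pos_iff.2 hy)).2 h
  have hc1 : ‖x / y‖ ≤ 1 := by
    calc ‖x / y‖ = ‖(x / y - 1) + 1‖ := by ring_nf
      _ ≤ max ‖x / y - 1‖ ‖(1 : ℚ_[p])‖ := Padic.nonarchimedean _ _
      _ ≤ 1 := max_le hc.le (by simp)
  let c : ℤ_[p] := ⟨x / y, hc1⟩
  have h2 : ‖(2 : ℤ_[p])‖ = 1 := by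
    have : ‖((2 : ℕ) : ℤ_[p])‖ = 1 := by
      rw [PadicInt.norm_natCast_eq_one_iff]
      exact (Nat.coprime_primes Fact.out Nat.prime_two).2 (by omega)
    simpa using this
  have hn : ‖1 - c‖ < 1 := by
    rw [norm_sub_rev]
    exact hc
  obtain ⟨r, hr, -⟩ := hensels_lemma (p := p) (R := ℤ_[p])
    (F := Polynomial.X ^ 2 - Polynomial.C c) (a := 1) (by simpa [one_add_one_eq_two, h2] using hn)
  have hr2 : r ^ 2 = c := by simpa [sub_eq_zero] using hr
  have hxy : ((r : ℚ_[p])) ^ 2 = x / y := by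
    rw [← PadicInt.coe_pow, hr2]
  refine ⟨r * y, ?_⟩
  have : x = (r : ℚ_[p]) ^ 2 * y := by rw [hxy]; field_simp
  rw [this]
  ring

theorem stmt17 (p : ℕ) [Fact p.Prime] (hp : 2 < p) (a b a' b' : ℚ_[p])
    (ha : a ≠ 0) (hb : b ≠ 0) (ha' : a' ≠ 0) (hb' : b' ≠ 0)
    (haZ : 0 ≤ a.valuation) (hbZ : 0 ≤ b.valuation)
    (haZ' : 0 ≤ a'.valuation) (hbZ' : 0 ≤ b'.valuation)
    (hab : a ≠ b) (hab' : a' ≠ b')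
    (hred : 1 ≤ (a - b).valuation) (hunit : a.valuation = 0)
    (hker : 4 ≤ {ε : Fin 4 → ZMod 2 | IsKernelVector a b a' b' ε}.ncard) :
    ∃ ε : Fin 4 → ZMod 2, ε ≠ 0 ∧ IsKernelVector a b a' b' ε ∧
      ε 2 = 0 ∧ ε 3 = 0 ∧
      ∀ x u z : ℚ_[p], z ≠ 0 →
        z ^ 2 = x * (x - a) * (x - b) * (u * (u - a') * (u - b')) →
        evMap a b a' b' ε x u = 0 := by
  have hna : ‖a‖ = 1 := by rw [Padic.norm_eq_zpow_neg_valuation ha, hunit]; simp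
  have hnab : ‖a - b‖ < 1 := by
    rw [Padic.norm_eq_zpow_neg_valuation (sub_ne_zero.2 hab)]
    exact zpow_lt_one_of_neg₀ (by exact_mod_cast (by omega : 1 < p)) (by omega)
  have hsq : IsSquare (a * b) := by
    rw [mul_comm]
    exact Padic.isSquare_mul_of_norm_sub_lt hp (by rwa [norm_sub_rev, hna])
  obtain ⟨ε, hε0, hε, hε2, hε3⟩ :=
    exists_isKernelVector_of_four_le_ncard ha hb ha' hb' hab hab' hsq hker
  refine ⟨ε, hε0, hε, hε2, hε3, fun x u z hz h => ?_⟩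
  have hne : x * (x - a) * (x - b) * (u * (u - a') * (u - b')) ≠ 0 := h ▸ pow_ne_zero 2 hz
  simp only [mul_ne_zero_iff] at hne
  obtain ⟨⟨⟨hx, hxa⟩, hxb⟩, ⟨hu, hua⟩, hub⟩ := hne
  have hD : (x - a) * (x - b) ≠ 0 := mul_ne_zero hxa hxb
  have hx_or : IsSquare ((x - a) * (x - b)) ∨ IsSquare (x * a) := by
    rcases lt_or_ge ‖x - a‖ 1 with hlt | hge
    · exact .inr (Padic.isSquare_mul_of_norm_sub_lt hp (by rwa [hna]))
    · left
      rw [mul_comm]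
      refine Padic.isSquare_mul_of_norm_sub_lt hp (lt_of_lt_of_le ?_ hge)
      rwa [show x - b - (x - a) = a - b by ring]
  have trivial_of {W α β : ℚ_[p]}
      (hW : u * (u - a') * (u - b') = W * (W + α) * (W + β))
      (hα : IsSquare (a * α)) (hβ : IsSquare (a * β)) :
      HilbertTrivial ((x - a) * (x - b)) ((W + α) * (W + β)) := by
    rcases hx_or with hs | hs
    · exact .of_isSquare_left _ hD hs
    · exact hilbertTrivial_of_isSquare hz (by rw [h, ← hW]; ring) ha hs hα hβ
  have hcases : ∀ c : ZMod 2, c = 0 ∨ c = 1 := by decide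
  have row₂ := hε 2
  have row₃ := hε 3
  rcases hcases (ε 0) with h0 | h0 <;> rcases hcases (ε 1) with h1 | h1
  · exact absurd (funext fun j => by fin_cases j <;> simp [h0, h1, hε2, hε3]) hε0
  · simp [Finset.prod_filter, Fin.prod_univ_four, SZMatrix, h0, h1, hε2, hε3] at row₂ row₃
    have key := trivial_of (W := u - a') (α := a') (β := a' - b') (by ring) row₂
      (isSquare_of_eq_sq_mul ha' (row₂.mul row₃) (by ring))
    rw [show (u - a' + a') * (u - a' + (a' - b')) = u * (u - b') by ring] at key
    simp [evMap, Finset.sum_filter, Fin.sum_univ_four, symPair, h0, h1, hε2, hε3, key]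
  · simp [Finset.prod_filter, Fin.prod_univ_four, SZMatrix, h0, h1, hε2, hε3] at row₂ row₃
    have key := trivial_of (W := u) (α := -a') (β := -b') (by ring)
      (by rwa [mul_neg])
      (isSquare_of_eq_sq_mul ha' (row₂.mul row₃) (by ring))
    rw [← sub_eq_add_neg, ← sub_eq_add_neg] at key
    simp [evMap, Finset.sum_filter, Fin.sum_univ_four, symPair, h0, h1, hε2, hε3, key]
  · simp [Finset.prod_filter, Fin.prod_univ_four, SZMatrix, h0, h1, hε2, hε3] at row₂ row₃
    have key := trivial_of (W := u - b') (α := b') (β := b' - a') (by ring)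
      (isSquare_of_eq_sq_mul ha' row₂ (by ring))
      (isSquare_of_eq_sq_mul ha' row₃ (by ring))
    rw [show (u - b' + b') * (u - b' + (b' - a')) = u * (u - a') by ring] at key
    have hiff : HilbertTrivial ((x - a) * (x - b)) ((u - a') * (u - b')) ↔
        HilbertTrivial ((x - a) * (x - b)) (u * (u - b')) := by
      constructor <;> intro hB
      · have := key.mul_right two_ne_zero hD hB
        rw [show u * (u - a') * ((u - a') * (u - b')) = u * (u - b') * (u - a') ^ 2 by ring]
          at this
        exact this.of_mul_sq
      · have := key.mul_right two_ne_zero hD hB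
        rw [show u * (u - a') * (u * (u - b')) = (u - a') * (u - b') * u ^ 2 by ring] at this
        exact this.of_mul_sq
    simp only [evMap, Finset.sum_filter, Fin.sum_univ_four, symPair, h0, h1, hε2, hε3]
    by_cases hB : HilbertTrivial ((x - a) * (x - b)) (u * (u - b'))
    · simp [hiff, hB]
    · simp [hiff, hB]
      decide
end
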